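/- Let G be a countable amenable group and F a continuous bundle random dynamical system over a measure-preserving dynamical system (Ω,𝓕,ℙ,G) on a compact metric space (X,d). Then the following three statements are equivalent: (1) F is Weyl-mean equicontinuous; (2) F is Banach-mean equicontinuous; (3) F is mean-L-stable. -/

import Mathlib

open Filter MeasureTheory Topology Metric Set ENNReal
open scoped symmDiff Classical

/-- `Φ` is a (left) Følner sequence of nonempty finite subsets of `G`. -/
def IsFolner {G : Type*} [Group G] (Φ : ℕ → Finset G) : Prop :=
  (∀ n, (Φ n).Nonempty) ∧
    ∀ g : G,
      Tendsto (fun n => ((((Φ n).image fun t => g * t) ∆ Φ n).card : ℝ) / ((Φ n).card : ℝ))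
        atTop (𝓝 0)

/-- The upper Banach density `BD*(E)` of a subset `E` of an amenable group `G`. -/
noncomputable def upperBanachDensity {G : Type*} [Group G] (E : Set G) : ℝ≥0∞ :=
  ⨆ (Φ : ℕ → Finset G) (_ : IsFolner Φ),
    Filter.limsup
      (fun n => (((Φ n).filter fun g => g ∈ E).card : ℝ≥0∞) / ((Φ n).card : ℝ≥0∞)) atTop

/-- A continuous bundle random dynamical system over the measure-preserving dynamical
system given by the measure-preserving action of `G` on the probability space `(Ω, μ)`,
with fibers `E ω ⊆ X` and fiber maps `F g ω : E ω → E (g • ω)`. -/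
structure RDS (G : Type*) [Group G] (Ω : Type*) [MeasurableSpace Ω] [MulAction G Ω]
    (μ : Measure Ω) (X : Type*) [MetricSpace X] [MeasurableSpace X] [BorelSpace X] where
  E : Ω → Set X
  F : G → Ω → X → X
  measurePreserving_smul : ∀ g : G, MeasurePreserving (fun ω : Ω => g • ω) μ μ
  measurableSet_carrier : MeasurableSet {p : Ω × X | p.2 ∈ E p.1}
  mapsTo : ∀ (g : G) (ω : Ω), Set.MapsTo (F g ω) (E ω) (E (g • ω))
  one_apply : ∀ (ω : Ω), ∀ x ∈ E ω, F 1 ω x = x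
  measurable_F : ∀ g : G, Measurable fun p : {p : Ω × X // p.2 ∈ E p.1} => F g p.1.1 p.1.2
  cocycle : ∀ (g₁ g₂ : G) (ω : Ω), ∀ x ∈ E ω, F g₂ (g₁ • ω) (F g₁ ω x) = F (g₂ * g₁) ω x
  ae_fiber : ∀ᵐ ω ∂μ, (E ω).Nonempty ∧ IsCompact (E ω) ∧ ∀ g : G, ContinuousOn (F g ω) (E ω)

namespace RDS

variable {G : Type*} [Group G] {Ω : Type*} [MeasurableSpace Ω] [MulAction G Ω]
  {μ : Measure Ω} {X : Type*} [MetricSpace X] [MeasurableSpace X] [BorelSpace X]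
  (S : RDS G Ω μ X)

/-- The carrier `𝓔 ⊆ Ω × X` of the RDS. -/
def carrier : Set (Ω × X) := {p : Ω × X | p.2 ∈ S.E p.1}

/-- `d̃(tx, ty) := sup_ω d(F_{t,ω} x, F_{t,ω} y)` when `x, y` lie in a common fiber,
and `∞` otherwise. -/
noncomputable def dt (t : G) (x y : X) : ℝ≥0∞ :=
  if ∃ ω : Ω, x ∈ S.E ω ∧ y ∈ S.E ω then
    ⨆ ω ∈ {ω : Ω | x ∈ S.E ω ∧ y ∈ S.E ω}, edist (S.F t ω x) (S.F t ω y)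
  else ⊤

/-- `D^{(r)}_𝓕(x,y) := limsup_n (1/|Φ n|) Σ_{t ∈ Φ n} d̃(tx,ty)`. -/
noncomputable def DFol (Φ : ℕ → Finset G) (x y : X) : ℝ≥0∞ :=
  Filter.limsup (fun n => (∑ t ∈ Φ n, S.dt t x y) / ((Φ n).card : ℝ≥0∞)) atTop

/-- The Weyl pseudometric `D^{(r)}(x,y)`, the sup over all Følner sequences. -/
noncomputable def DW (x y : X) : ℝ≥0∞ :=
  ⨆ (Φ : ℕ → Finset G) (_ : IsFolner Φ), S.DFol Φ x y

/-- The Banach pseudometric `D̄^{(r)}(x,y) := inf_K sup_g (1/|K|) Σ_{t ∈ Kg} d̃(tx,ty)`. -/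
noncomputable def DB (x y : X) : ℝ≥0∞ :=
  ⨅ (K : Finset G) (_ : K.Nonempty),
    ⨆ g : G, (∑ t ∈ K.image fun k => k * g, S.dt t x y) / ((K.card : ℝ≥0∞))

/-- Weyl-mean equicontinuity of the RDS. -/
def WME : Prop :=
  ∀ ε : ℝ, 0 < ε → ∃ δ : ℝ, 0 < δ ∧ ∀ (ω : Ω) (x y : X),
    x ∈ S.E ω → y ∈ S.E ω → dist x y < δ → S.DW x y < ENNReal.ofReal ε

/-- Banach-mean equicontinuity of the RDS. -/
def BME : Prop :=
  ∀ ε : ℝ, 0 < ε → ∃ δ : ℝ, 0 < δ ∧ ∀ (ω : Ω) (x y : X),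
    x ∈ S.E ω → y ∈ S.E ω → dist x y < δ → S.DB x y < ENNReal.ofReal ε

/-- Mean-L-stability: points starting close stay `ε`-close outside a set of
upper Banach density less than `ε`. -/
def MeanLStable : Prop :=
  ∀ ε : ℝ, 0 < ε → ∃ δ : ℝ, 0 < δ ∧ ∀ (ω : Ω) (x y : X),
    x ∈ S.E ω → y ∈ S.E ω → dist x y < δ →
      upperBanachDensity {g : G | ENNReal.ofReal ε ≤ S.dt g x y} < ENNReal.ofReal ε

/-- `Ĥ^{(r)}_{𝓕,ω}(x,y)`. -/
noncomputable def HFol (Φ : ℕ → Finset G) (ω : Ω) (x y : X) : ℝ≥0∞ :=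
  if x ∈ S.E ω ∧ y ∈ S.E ω then
    Filter.limsup
      (fun n => (∑ t ∈ Φ n, edist (S.F t ω x) (S.F t ω y)) / ((Φ n).card : ℝ≥0∞)) atTop
  else ⊤

/-- `Ĥ^{(r)}_ω(x,y)`, the sup over all Følner sequences of `Ĥ^{(r)}_{𝓕,ω}(x,y)`. -/
noncomputable def HW (ω : Ω) (x y : X) : ℝ≥0∞ :=
  ⨆ (Φ : ℕ → Finset G) (_ : IsFolner Φ), S.HFol Φ ω x y

/-- `Ĥ^{(r)}(x,y) := sup_ω Ĥ^{(r)}_ω(x,y)`. -/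
noncomputable def Hsup (x y : X) : ℝ≥0∞ := ⨆ ω : Ω, S.HW ω x y

/-- Weyl-mean sensitivity of the RDS. -/
def WeylMeanSensitive : Prop :=
  ∃ δ : ℝ, 0 < δ ∧ ∀ (x : X) (ε : ℝ), 0 < ε →
    ∃ (ω : Ω) (y : X), y ∈ S.E ω ∩ Metric.ball x ε ∧ ENNReal.ofReal δ < S.HW ω x y

/-- The set `𝔼_{ω,ε}` of points of `E ω` around which the Weyl pseudometric is
uniformly `< ε` on a small relative ball. -/
def EE (ω : Ω) (ε : ℝ) : Set X :=
  {x ∈ S.E ω | ∃ δ : ℝ, 0 < δ ∧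
    ∀ y ∈ Metric.ball x δ ∩ S.E ω, ∀ z ∈ Metric.ball x δ ∩ S.E ω,
      S.DW y z < ENNReal.ofReal ε}

/-- The set `𝔼` of Weyl-mean equicontinuous points of the RDS. -/
def meanEqPts : Set X :=
  {x : X | ∀ ε : ℝ, 0 < ε → ∃ δ : ℝ, 0 < δ ∧ ∀ (ω : Ω) (y : X),
    y ∈ S.E ω → dist x y < δ → S.DW x y < ENNReal.ofReal ε}

end RDS

/-- `D_𝓕(x,y)` for a (deterministic) group action `T` of `G` on `K`. -/
noncomputable def actDFol {G K : Type*} [Group G] [PseudoMetricSpace K]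
    (T : G → K → K) (Φ : ℕ → Finset G) (x y : K) : ℝ≥0∞ :=
  Filter.limsup (fun n => (∑ t ∈ Φ n, edist (T t x) (T t y)) / ((Φ n).card : ℝ≥0∞)) atTop

/-- The Weyl pseudometric `D(x,y)` for a group action. -/
noncomputable def actDW {G K : Type*} [Group G] [PseudoMetricSpace K]
    (T : G → K → K) (x y : K) : ℝ≥0∞ :=
  ⨆ (Φ : ℕ → Finset G) (_ : IsFolner Φ), actDFol T Φ x y

/-- The Banach pseudometric `D̄(x,y)` for a group action. -/
noncomputable def actDB {G K : Type*} [Group G] [PseudoMetricSpace K]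
    (T : G → K → K) (x y : K) : ℝ≥0∞ :=
  ⨅ (F : Finset G) (_ : F.Nonempty),
    ⨆ g : G, (∑ t ∈ F.image fun k => k * g, edist (T t x) (T t y)) / ((F.card : ℝ≥0∞))

/-- The set of Weyl-mean equicontinuous points of a group action. -/
def actMeanEqPts {G K : Type*} [Group G] [PseudoMetricSpace K]
    (T : G → K → K) : Set K :=
  {x : K | ∀ ε : ℝ, 0 < ε → ∃ δ : ℝ, 0 < δ ∧
    ∀ y : K, dist x y < δ → actDW T x y < ENNReal.ofReal ε}

/-- For a bounded function, averages along a Følner sequence are asymptotically bounded by the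
supremum of its averages over the right translates of any fixed nonempty finite set. -/
theorem IsFolner.limsup_average_le {G : Type*} [Group G] {Φ : ℕ → Finset G} (hΦ : IsFolner Φ)
    {f : G → ℝ≥0∞} {M : ℝ≥0∞} (hM : M ≠ ⊤) (hf : ∀ g, f g ≤ M) {K : Finset G}
    (hK : K.Nonempty) :
    limsup (fun n => (∑ t ∈ Φ n, f t) / ((Φ n).card : ℝ≥0∞)) atTop ≤
      ⨆ g : G, (∑ t ∈ K.image fun k => k * g, f t) / (K.card : ℝ≥0∞) := by
  set B := ⨆ g : G, (∑ t ∈ K.image fun k => k * g, f t) / (K.card : ℝ≥0∞)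
  let r : G → ℕ → ℝ≥0∞ := fun k n =>
    ((((Φ n).image fun t => k * t) ∆ Φ n).card : ℝ≥0∞) / ((Φ n).card : ℝ≥0∞)
  have hr : ∀ k, Tendsto (r k) atTop (𝓝 0) := by
    intro k
    have h := ENNReal.tendsto_ofReal (hΦ.2 k)
    rw [ENNReal.ofReal_zero] at h
    refine h.congr fun n => ?_
    rw [ENNReal.ofReal_div_of_pos (by exact_mod_cast (hΦ.1 n).card_pos),
      ENNReal.ofReal_natCast, ENNReal.ofReal_natCast]
  have hlim : Tendsto (fun n => B + M * ∑ k ∈ K, r k n) atTop (𝓝 B) := by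
    have h := ENNReal.Tendsto.const_mul (a := M) (tendsto_finsetSum K fun k _ => hr k)
      (Or.inr hM)
    simpa using tendsto_const_nhds.add h
  rw [← hlim.limsup_eq]
  refine limsup_le_limsup (Eventually.of_forall fun n => ?_)
  have hc0 : ((Φ n).card : ℝ≥0∞) ≠ 0 := by exact_mod_cast (hΦ.1 n).card_pos.ne'
  have hct : ((Φ n).card : ℝ≥0∞) ≠ ⊤ := ENNReal.natCast_ne_top _
  have hK0 : (K.card : ℝ≥0∞) ≠ 0 := by exact_mod_cast hK.card_pos.ne'
  have hKt : (K.card : ℝ≥0∞) ≠ ⊤ := ENNReal.natCast_ne_top _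
  have hK1 : (1 : ℝ≥0∞) ≤ K.card := by exact_mod_cast hK.card_pos
  have htrans : ∀ k, ∑ t ∈ Φ n, f t ≤
      ∑ t ∈ Φ n, f (k * t) + M * (r k n * (Φ n).card) := by
    intro k
    rw [ENNReal.div_mul_cancel hc0 hct]
    set I := (Φ n).image fun t => k * t
    calc ∑ t ∈ Φ n, f t ≤ ∑ t ∈ I ∪ I ∆ Φ n, f t := by
          refine Finset.sum_le_sum_of_subset fun t ht => ?_
          by_cases htI : t ∈ I <;> simp [Finset.mem_symmDiff, ht, htI]
      _ ≤ ∑ t ∈ I, f t + ∑ t ∈ I ∆ Φ n, f t := by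
          rw [← Finset.sum_union_inter]
          exact le_self_add
      _ ≤ _ := by
          refine add_le_add (le_of_eq ?_) ?_
          · exact Finset.sum_image fun a _ b _ h => mul_left_cancel h
          · refine (Finset.sum_le_card_nsmul _ _ M fun t _ => hf t).trans_eq ?_
            rw [nsmul_eq_mul, mul_comm]
  have hBsum : ∀ g, ∑ k ∈ K, f (k * g) ≤ B * K.card := by
    intro g
    rw [← ENNReal.div_le_iff hK0 hKt]
    refine le_trans (le_of_eq ?_)
      (le_iSup (fun g : G => (∑ t ∈ K.image fun k => k * g, f t) / (K.card : ℝ≥0∞)) g)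
    rw [Finset.sum_image fun a _ b _ h => mul_right_cancel h]
  rw [ENNReal.div_le_iff hc0 hct]
  refine (ENNReal.mul_le_mul_iff_right hK0 hKt).1 ?_
  calc (K.card : ℝ≥0∞) * ∑ t ∈ Φ n, f t = ∑ _k ∈ K, ∑ t ∈ Φ n, f t := by
        rw [Finset.sum_const, nsmul_eq_mul]
    _ ≤ ∑ k ∈ K, (∑ t ∈ Φ n, f (k * t) + M * (r k n * (Φ n).card)) :=
        Finset.sum_le_sum fun k _ => htrans k
    _ = ∑ t ∈ Φ n, ∑ k ∈ K, f (k * t) + M * (∑ k ∈ K, r k n) * (Φ n).card := by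
        rw [Finset.sum_add_distrib, Finset.sum_comm, ← Finset.mul_sum, ← Finset.sum_mul, mul_assoc]
    _ ≤ (Φ n).card * (B * K.card) + K.card * (M * (∑ k ∈ K, r k n) * (Φ n).card) := by
        refine add_le_add ?_ (le_mul_of_one_le_left' hK1)
        refine (Finset.sum_le_card_nsmul _ _ _ fun t _ => hBsum t).trans_eq ?_
        rw [nsmul_eq_mul]
    _ = K.card * ((B + M * ∑ k ∈ K, r k n) * (Φ n).card) := by ring

/-- Right translates of the terms of a Følner sequence form a Følner sequence. -/
theorem IsFolner.image_mul_right {G : Type*} [Group G] {Φ : ℕ → Finset G} (hΦ : IsFolner Φ)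
    (g : ℕ → G) : IsFolner fun n => (Φ n).image fun t => t * g n := by
  refine ⟨fun n => (hΦ.1 n).image _, fun a => (hΦ.2 a).congr fun n => ?_⟩
  have hinj : Function.Injective fun t : G => t * g n := mul_left_injective (g n)
  have himage : ((Φ n).image fun t => t * g n).image (fun t => a * t) =
      ((Φ n).image fun t => a * t).image fun t => t * g n := by
    simp only [Finset.image_image, Function.comp_def, mul_assoc]
  rw [himage, ← Finset.image_symmDiff _ _ hinj, Finset.card_image_of_injective _ hinj,
    Finset.card_image_of_injective _ hinj]

/-- The supremum over Følner sequences of the upper averages of a bounded function equals the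
infimum over finite sets of the supremum of its averages over right translates. -/
theorem iSup_limsup_average_eq_iInf {G : Type*} [Group G]
    (hG : ∃ Φ : ℕ → Finset G, IsFolner Φ) {f : G → ℝ≥0∞} {M : ℝ≥0∞} (hM : M ≠ ⊤)
    (hf : ∀ g, f g ≤ M) :
    (⨆ (Φ : ℕ → Finset G) (_ : IsFolner Φ),
      limsup (fun n => (∑ t ∈ Φ n, f t) / ((Φ n).card : ℝ≥0∞)) atTop) =
    ⨅ (K : Finset G) (_ : K.Nonempty),
      ⨆ g : G, (∑ t ∈ K.image fun k => k * g, f t) / (K.card : ℝ≥0∞) := by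
  refine le_antisymm
    (iSup₂_le fun Φ hΦ => le_iInf₂ fun K hK => hΦ.limsup_average_le hM hf hK) ?_
  obtain ⟨Φ, hΦ⟩ := hG
  refine le_of_forall_lt fun c hc => ?_
  obtain ⟨c', hcc', hc'⟩ := exists_between hc
  have hex : ∀ n, ∃ g : G,
      c' < (∑ t ∈ (Φ n).image fun k => k * g, f t) / ((Φ n).card : ℝ≥0∞) := fun n =>
    lt_iSup_iff.1 (hc'.trans_le (iInf₂_le (Φ n) (hΦ.1 n)))
  choose g hg using hex
  refine hcc'.trans_le (le_trans ?_ (le_iSup₂ _ (hΦ.image_mul_right g)))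
  refine le_limsup_of_frequently_le (Eventually.of_forall fun n => ?_).frequently
  rw [Finset.card_image_of_injective _ (mul_left_injective (g n))]
  exact (hg n).le

/-- Markov's inequality for the upper Banach density. -/
theorem upperBanachDensity_le_div {G : Type*} [Group G] (f : G → ℝ≥0∞) {c : ℝ≥0∞}
    (hc0 : c ≠ 0) (hc : c ≠ ⊤) {E : Set G} (hE : ∀ g ∈ E, c ≤ f g) :
    upperBanachDensity E ≤
      (⨆ (Φ : ℕ → Finset G) (_ : IsFolner Φ),
        limsup (fun n => (∑ t ∈ Φ n, f t) / ((Φ n).card : ℝ≥0∞)) atTop) / c := by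
  refine iSup₂_le fun Φ hΦ => ?_
  rw [ENNReal.le_div_iff_mul_le (Or.inl hc0) (Or.inl hc)]
  refine le_trans ?_ (le_iSup₂ Φ hΦ)
  rw [mul_comm, ← ENNReal.limsup_const_mul_of_ne_top hc]
  refine limsup_le_limsup (Eventually.of_forall fun n => ?_)
  simp only
  rw [← mul_div_assoc]
  gcongr
  calc c * (((Φ n).filter fun g => g ∈ E).card : ℝ≥0∞)
      = ((Φ n).filter fun g => g ∈ E).card • c := by rw [nsmul_eq_mul, mul_comm]
    _ ≤ ∑ t ∈ (Φ n).filter fun g => g ∈ E, f t :=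
        Finset.card_nsmul_le_sum _ _ _ fun t ht => hE t (Finset.mem_filter.1 ht).2
    _ ≤ ∑ t ∈ Φ n, f t := Finset.sum_le_sum_of_subset (Finset.filter_subset _ _)

/-- If `f ≤ M` and `f ≤ c` outside a set of upper Banach density less than `c`, then the upper
averages of `f` along Følner sequences are at most `c + M * c`. -/
theorem iSup_limsup_average_le_of_upperBanachDensity_lt {G : Type*} [Group G]
    {f : G → ℝ≥0∞} {c M : ℝ≥0∞} (hf : ∀ g, f g ≤ M) {E : Set G} (hE : ∀ g ∉ E, f g ≤ c)
    (h : upperBanachDensity E < c) :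
    (⨆ (Φ : ℕ → Finset G) (_ : IsFolner Φ),
      limsup (fun n => (∑ t ∈ Φ n, f t) / ((Φ n).card : ℝ≥0∞)) atTop) ≤ c + M * c := by
  refine iSup₂_le fun Φ hΦ => ?_
  have hlt := (le_iSup₂ (f := fun (Φ : ℕ → Finset G) (_ : IsFolner Φ) => limsup
    (fun n => (((Φ n).filter fun g => g ∈ E).card : ℝ≥0∞) / ((Φ n).card : ℝ≥0∞))
      atTop) Φ hΦ).trans_lt h
  refine limsup_le_of_le (h := ?_)
  filter_upwards [eventually_lt_of_limsup_lt hlt] with n hn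
  have hc0 : ((Φ n).card : ℝ≥0∞) ≠ 0 := by exact_mod_cast (hΦ.1 n).card_pos.ne'
  have hct : ((Φ n).card : ℝ≥0∞) ≠ ⊤ := ENNReal.natCast_ne_top _
  have hn' := (ENNReal.div_le_iff hc0 hct).1 hn.le
  rw [ENNReal.div_le_iff hc0 hct]
  calc ∑ t ∈ Φ n, f t
      ≤ ∑ t ∈ Φ n, (c + if t ∈ E then M else 0) := by
        refine Finset.sum_le_sum fun t _ => ?_
        split_ifs with ht
        · exact (hf t).trans le_add_self
        · simpa using hE t ht
    _ = (Φ n).card * c + ((Φ n).filter fun g => g ∈ E).card * M := by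
        rw [Finset.sum_add_distrib, ← Finset.sum_filter]
        simp only [Finset.sum_const, nsmul_eq_mul]
    _ ≤ (Φ n).card * c + c * (Φ n).card * M := by gcongr
    _ = (c + M * c) * (Φ n).card := by ring

namespace RDS

variable {G : Type*} [Group G] {Ω : Type*} [MeasurableSpace Ω] [MulAction G Ω]
  {μ : Measure Ω} {X : Type*} [MetricSpace X] [MeasurableSpace X] [BorelSpace X]
  (S : RDS G Ω μ X)

theorem dt_le_ediam {ω : Ω} {x y : X} (hx : x ∈ S.E ω) (hy : y ∈ S.E ω) (t : G) :
    S.dt t x y ≤ Metric.ediam (Set.univ : Set X) := by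
  rw [dt, if_pos ⟨ω, hx, hy⟩]
  exact iSup₂_le fun _ _ => Metric.edist_le_ediam_of_mem (Set.mem_univ _) (Set.mem_univ _)

theorem DW_eq_DB [CompactSpace X] (hG : ∃ Φ : ℕ → Finset G, IsFolner Φ) {ω : Ω} {x y : X}
    (hx : x ∈ S.E ω) (hy : y ∈ S.E ω) : S.DW x y = S.DB x y :=
  iSup_limsup_average_eq_iInf hG isCompact_univ.isBounded.ediam_ne_top (S.dt_le_ediam hx hy)

theorem wme_iff_bme [CompactSpace X] (hG : ∃ Φ : ℕ → Finset G, IsFolner Φ) :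
    S.WME ↔ S.BME := by
  refine forall₂_congr fun ε _ => exists_congr fun δ => and_congr_right fun _ =>
    forall₅_congr fun ω x y hx hy => ?_
  rw [S.DW_eq_DB hG hx hy]

variable {S}

theorem WME.meanLStable (h : S.WME) : S.MeanLStable := by
  intro ε hε
  obtain ⟨δ, hδ, H⟩ := h (ε * ε) (mul_pos hε hε)
  refine ⟨δ, hδ, fun ω x y hx hy hxy => ?_⟩
  have hε0 : ENNReal.ofReal ε ≠ 0 := (ENNReal.ofReal_pos.2 hε).ne'
  refine (upperBanachDensity_le_div (fun g => S.dt g x y) hε0 ENNReal.ofReal_ne_top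
    fun _ hg => hg).trans_lt ?_
  rw [ENNReal.div_lt_iff (Or.inl hε0) (Or.inl ENNReal.ofReal_ne_top), ← ENNReal.ofReal_mul hε.le]
  exact H ω x y hx hy hxy

theorem MeanLStable.wme [CompactSpace X] (h : S.MeanLStable) : S.WME := by
  intro ε hε
  set M := (Metric.ediam (Set.univ : Set X)).toReal
  have hM0 : 0 ≤ M := ENNReal.toReal_nonneg
  have hMe : Metric.ediam (Set.univ : Set X) = ENNReal.ofReal M :=
    (ENNReal.ofReal_toReal isCompact_univ.isBounded.ediam_ne_top).symm
  have hη : 0 < ε / (2 * (1 + M)) := by positivity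
  obtain ⟨δ, hδ, H⟩ := h _ hη
  refine ⟨δ, hδ, fun ω x y hx hy hxy => ?_⟩
  refine (iSup_limsup_average_le_of_upperBanachDensity_lt (S.dt_le_ediam hx hy)
    (fun _ hg => (not_le.1 hg).le) (H ω x y hx hy hxy)).trans_lt ?_
  rw [hMe, ← ENNReal.ofReal_mul hM0, ← ENNReal.ofReal_add hη.le (by positivity)]
  refine (ENNReal.ofReal_lt_ofReal_iff hε).2 ?_
  have : ε / (2 * (1 + M)) + M * (ε / (2 * (1 + M))) = ε / 2 := by field_simp
  linarith

end RDS

/-- For an RDS over a countable amenable group, Weyl-mean equicontinuity,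
Banach-mean equicontinuity and mean-L-stability are all equivalent. -/
theorem wme_iff_bme_iff_meanLStable
    {G : Type*} [Group G] [Countable G]
    {Ω : Type*} [MeasurableSpace Ω] [MulAction G Ω]
    {μ : Measure Ω} [IsProbabilityMeasure μ]
    {X : Type*} [MetricSpace X] [CompactSpace X] [MeasurableSpace X] [BorelSpace X]
    (hG : ∃ Φ : ℕ → Finset G, IsFolner Φ)
    (S : RDS G Ω μ X) :
    (S.WME ↔ S.BME) ∧ (S.BME ↔ S.MeanLStable) := by
  have h₁ := S.wme_iff_bme hG
  exact ⟨h₁, fun h => (h₁.2 h).meanLStable, fun h => h₁.1 h.wme⟩
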